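/- The autotransformation formula holds: Ψ_{pq}[a,b,c,d; a',b' | e; c',d'; σ, θ, ρ] = (1−θ)^{d−b} · Ψ_{pq}[a,d,c,b; a',b' | e; c',d'; σ, θ, ρ], i.e., swapping the parameters b and d in the second and fourth slots multiplies the function by (1−θ)^{b−d}. -/

import Mathlib

open Complex

/-- Pochhammer symbol `(a)_n = a(a+1)⋯(a+n-1)` for complex `a`. -/
noncomputable def poch (a : ℂ) (n : ℕ) : ℂ := (ascPochhammer ℂ n).eval a

/-- `c` is not a nonpositive integer `0, -1, -2, …`. -/
def notNonposInt (c : ℂ) : Prop := ∀ n : ℕ, c ≠ -(n : ℂ)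

/-- Confluent hypergeometric series `Ξ₂(a,b;c;σ,ρ)`. -/
noncomputable def Xi2 (a b c σ ρ : ℂ) : ℂ :=
  ∑' mk : ℕ × ℕ, poch a mk.1 * poch b mk.1 /
    ((mk.1.factorial : ℂ) * (mk.2.factorial : ℂ) * poch c (mk.1 + mk.2)) * σ ^ mk.1 * ρ ^ mk.2

/-- Series `Ξ₁₀[a,b;a' | c; c'; σ,ρ]`. -/
noncomputable def Xi10 (a b a' c c' σ ρ : ℂ) : ℂ :=
  ∑' mk : ℕ × ℕ, poch a mk.1 * poch b mk.1 * poch a' mk.2 /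
    ((mk.1.factorial : ℂ) * (mk.2.factorial : ℂ) * poch c (mk.1 + mk.2) * poch c' mk.2) *
    σ ^ mk.1 * ρ ^ mk.2

/-- Triple hypergeometric series `Φ[a,b,c,d;e;σ,ω,ρ]`. -/
noncomputable def Phi3 (a b c d e σ ω ρ : ℂ) : ℂ :=
  ∑' t : ℕ × ℕ × ℕ, poch a t.1 * poch b t.2.1 * poch c t.1 * poch d t.2.1 /
    ((t.1.factorial : ℂ) * (t.2.1.factorial : ℂ) * (t.2.2.factorial : ℂ) *
      poch e (t.1 + t.2.1 + t.2.2)) *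
    σ ^ t.1 * ω ^ t.2.1 * ρ ^ t.2.2

/-- Gauss hypergeometric series `F(a,b;c;θ)`. -/
noncomputable def GaussF (a b c θ : ℂ) : ℂ :=
  ∑' n : ℕ, poch a n * poch b n / ((n.factorial : ℂ) * poch c n) * θ ^ n

/-- Series `Ξ_{pq}[a,b;a',b' | c; c',d'; σ,ρ]`, `p, q ∈ {0,1}`. -/
noncomputable def XiPQ (p q : ℕ) (a b a' b' c c' d' σ ρ : ℂ) : ℂ :=
  ∑' mk : ℕ × ℕ, poch a mk.1 * poch b mk.1 * poch a' (p * mk.2) * poch b' (q * (mk.1 + mk.2)) /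
    ((mk.1.factorial : ℂ) * (mk.2.factorial : ℂ) * poch c (mk.1 + mk.2) *
      poch c' (p * mk.2) * poch d' (q * (mk.1 + mk.2))) *
    σ ^ mk.1 * ρ ^ mk.2

/-- Series `Ψ_{pq}[a,b,c,d;a',b' | e; c',d'; σ,θ,ρ]`, `p, q ∈ {0,1}`. -/
noncomputable def PsiPQ (p q : ℕ) (a b c d a' b' e c' d' σ θ ρ : ℂ) : ℂ :=
  ∑' mk : ℕ × ℕ, poch a mk.1 * poch c mk.1 * poch a' (p * mk.2) * poch b' (q * (mk.1 + mk.2)) /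
    ((mk.1.factorial : ℂ) * (mk.2.factorial : ℂ) * poch e (mk.1 + mk.2) *
      poch c' (p * mk.2) * poch d' (q * (mk.1 + mk.2))) *
    GaussF b (e - d + (mk.1 : ℂ) + (mk.2 : ℂ)) (e + (mk.1 : ℂ) + (mk.2 : ℂ)) θ *
    σ ^ mk.1 * ρ ^ mk.2

theorem poch_zero (a : ℂ) : poch a 0 = 1 := by simp [poch]

theorem poch_succ (a : ℂ) (n : ℕ) : poch a (n + 1) = poch a n * (a + n) := by
  simp [poch, ascPochhammer_succ_eval]

theorem notNonposInt.add_natCast_ne_zero {c : ℂ} (hc : notNonposInt c) (n : ℕ) :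
    c + n ≠ 0 := fun h => hc n (eq_neg_of_add_eq_zero_left h)

theorem notNonposInt.add_natCast {c : ℂ} (hc : notNonposInt c) (n : ℕ) :
    notNonposInt (c + n) := fun k h => hc (n + k) (by push_cast; linear_combination h)

theorem notNonposInt.poch_ne_zero {c : ℂ} (hc : notNonposInt c) (n : ℕ) : poch c n ≠ 0 := by
  induction n with
  | zero => simp [poch_zero]
  | succ n ih => exact poch_succ c n ▸ mul_ne_zero ih (hc.add_natCast_ne_zero n)

/-- The `n`-th Taylor coefficient of `F(a,b;c;·)` at `0`. -/
noncomputable def gaussCoeff (a b c : ℂ) (n : ℕ) : ℂ :=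
  poch a n * poch b n / ((n.factorial : ℂ) * poch c n)

theorem gaussCoeff_zero (a b c : ℂ) : gaussCoeff a b c 0 = 1 := by
  simp [gaussCoeff, poch_zero]

theorem gaussCoeff_succ {a b c : ℂ} (hc : notNonposInt c) (n : ℕ) :
    gaussCoeff a b c (n + 1) =
      gaussCoeff a b c n * ((a + n) * (b + n) / ((n + 1) * (c + n))) := by
  have h₁ := hc.poch_ne_zero n
  have h₂ := hc.add_natCast_ne_zero n
  have h₃ : (n : ℂ) + 1 ≠ 0 := n.cast_add_one_ne_zero
  have h₄ : (n.factorial : ℂ) ≠ 0 := by exact_mod_cast n.factorial_ne_zero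
  simp only [gaussCoeff, poch_succ, Nat.factorial_succ]
  push_cast
  field_simp

/-- The `n`-th Taylor coefficient of `(1 - x) ^ (-s)` at `0`. -/
noncomputable def binomCoeff (s : ℂ) (n : ℕ) : ℂ := poch s n / (n.factorial : ℂ)

theorem binomCoeff_succ (s : ℂ) (n : ℕ) :
    (n + 1) * binomCoeff s (n + 1) = (s + n) * binomCoeff s n := by
  have h₃ : (n : ℂ) + 1 ≠ 0 := n.cast_add_one_ne_zero
  have h₄ : (n.factorial : ℂ) ≠ 0 := by exact_mod_cast n.factorial_ne_zero
  simp only [binomCoeff, poch_succ, Nat.factorial_succ]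
  push_cast
  field_simp

theorem binomCoeff_eq_choose (s : ℂ) (n : ℕ) : binomCoeff s n = Ring.choose (s + n - 1) n := by
  have h₄ : (n.factorial : ℂ) ≠ 0 := by exact_mod_cast n.factorial_ne_zero
  have h := Ring.factorial_nsmul_multichoose_eq_ascPochhammer s n
  rw [Polynomial.ascPochhammer_smeval_eq_eval, nsmul_eq_mul] at h
  rw [binomCoeff, poch, ← h, mul_div_cancel_left₀ _ h₄, Ring.choose]
  congr 1
  ring

theorem hasSum_binomCoeff (s : ℂ) {x : ℂ} (hx : ‖x‖ < 1) :
    HasSum (fun n => binomCoeff s n * x ^ n) ((1 - x) ^ (-s)) := by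
  have h := (Complex.one_div_one_sub_cpow_hasFPowerSeriesOnBall_zero s).hasSum (y := x)
    (by simpa [← ofReal_norm] using hx)
  simpa [FormalMultilinearSeries.ofScalars_apply_eq, ← binomCoeff_eq_choose, cpow_neg, mul_comm] using h

open Filter Topology in
theorem summable_gaussCoeff (a b : ℂ) {c x : ℂ} (hc : notNonposInt c) (hx : ‖x‖ < 1) :
    Summable fun n => gaussCoeff a b c n * x ^ n := by
  obtain ⟨r, hxr, hr⟩ := exists_between hx
  have h₁ : Tendsto (fun n : ℕ => (a + n) / (1 + n)) atTop (𝓝 1) := by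
    simpa using tendsto_add_mul_div_add_mul_atTop_nhds a 1 (1 : ℂ) one_ne_zero
  have h₂ : Tendsto (fun n : ℕ => (b + n) / (c + n)) atTop (𝓝 1) := by
    simpa using tendsto_add_mul_div_add_mul_atTop_nhds b c (1 : ℂ) one_ne_zero
  have h : Tendsto (fun n : ℕ => ‖(a + n) / (1 + n) * ((b + n) / (c + n)) * x‖) atTop
      (𝓝 ‖x‖) := by
    simpa using ((h₁.mul h₂).mul_const x).norm
  refine summable_of_ratio_norm_eventually_le hr ?_
  filter_upwards [h.eventually (eventually_le_nhds hxr)] with n hn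
  have : gaussCoeff a b c (n + 1) * x ^ (n + 1) =
      (a + n) / (1 + n) * ((b + n) / (c + n)) * x * (gaussCoeff a b c n * x ^ n) := by
    rw [gaussCoeff_succ hc, div_mul_div_comm, pow_succ, add_comm (n : ℂ) 1]
    ring
  rw [this, norm_mul]
  gcongr

/-- Telescoping certificate for the Pfaff–Saalschütz sum. -/
theorem gaussCoeff_mul_binomCoeff_telescope (a b : ℂ) {c : ℂ} (hc : notNonposInt c) (k j : ℕ) :
    (k + j + 1) * (c + k + j) * (gaussCoeff a b c k * binomCoeff (c - a - b) (j + 1)) -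
        (c - a + k + j) * (c - b + k + j) * (gaussCoeff a b c k * binomCoeff (c - a - b) j) =
      k * (c + k - 1) * gaussCoeff a b c k * binomCoeff (c - a - b) (j + 1) -
        (k + 1) * (c + k) * gaussCoeff a b c (k + 1) * binomCoeff (c - a - b) j := by
  have h₂ := hc.add_natCast_ne_zero k
  have h₃ : (k : ℂ) + 1 ≠ 0 := k.cast_add_one_ne_zero
  have h₄ : (j : ℂ) + 1 ≠ 0 := j.cast_add_one_ne_zero
  have hb : binomCoeff (c - a - b) (j + 1) =
      (c - a - b + j) * binomCoeff (c - a - b) j / (j + 1) := by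
    rw [← binomCoeff_succ, mul_div_cancel_left₀ _ h₄]
  rw [gaussCoeff_succ hc, hb]
  field_simp
  ring

/-- The Pfaff–Saalschütz summation formula. -/
theorem sum_gaussCoeff_mul_binomCoeff (a b : ℂ) {c : ℂ} (hc : notNonposInt c) (n : ℕ) :
    ∑ k ∈ Finset.range (n + 1), gaussCoeff a b c k * binomCoeff (c - a - b) (n - k) =
      gaussCoeff (c - a) (c - b) c n := by
  induction n with
  | zero => simp [gaussCoeff_zero, binomCoeff, poch_zero]
  | succ n ih =>
    have h₂ := hc.add_natCast_ne_zero n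
    have h₃ : (n : ℂ) + 1 ≠ 0 := n.cast_add_one_ne_zero
    let G : ℕ → ℂ := fun k =>
      k * (c + k - 1) * gaussCoeff a b c k * binomCoeff (c - a - b) (n + 1 - k)
    have hG : ∀ k ∈ Finset.range (n + 1),
        (n + 1) * (c + n) * (gaussCoeff a b c k * binomCoeff (c - a - b) (n + 1 - k)) -
          (c - a + n) * (c - b + n) * (gaussCoeff a b c k * binomCoeff (c - a - b) (n - k)) =
        G k - G (k + 1) := by
      intro k hk
      obtain ⟨j, rfl⟩ := Nat.exists_eq_add_of_le (Nat.lt_succ_iff.1 (Finset.mem_range.1 hk))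
      have h := gaussCoeff_mul_binomCoeff_telescope a b hc k j
      have e₁ : k + j + 1 - k = j + 1 := by lia
      have e₂ : k + j - k = j := by lia
      have e₃ : k + j + 1 - (k + 1) = j := by lia
      simp only [G, e₁, e₂, e₃]
      push_cast
      linear_combination h
    have hsum := Finset.sum_congr rfl hG
    rw [Finset.sum_range_sub', Finset.sum_sub_distrib, ← Finset.mul_sum, ← Finset.mul_sum,
      ih] at hsum
    rw [gaussCoeff_succ hc, Finset.sum_range_succ]
    simp only [G, Nat.sub_self, Nat.cast_zero] at hsum ⊢
    push_cast at hsum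
    rw [mul_div_assoc', eq_div_iff (mul_ne_zero h₃ h₂)]
    linear_combination hsum

/-- Euler's transformation of the Gauss hypergeometric function. -/
theorem GaussF_euler (a b : ℂ) {c x : ℂ} (hc : notNonposInt c) (hx : ‖x‖ < 1) :
    GaussF a b c x = (1 - x) ^ (c - a - b) * GaussF (c - a) (c - b) c x := by
  have hx₁ : 1 - x ≠ 0 := by
    intro h
    rw [← sub_eq_zero.1 h, norm_one] at hx
    exact lt_irrefl _ hx
  have hs := hasSum_binomCoeff (c - a - b) hx
  have h := tsum_mul_tsum_eq_tsum_sum_range_of_summable_norm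
    (summable_gaussCoeff a b hc hx).norm hs.summable.norm
  have hterm (n : ℕ) : ∑ k ∈ Finset.range (n + 1), gaussCoeff a b c k * x ^ k *
      (binomCoeff (c - a - b) (n - k) * x ^ (n - k)) =
      gaussCoeff (c - a) (c - b) c n * x ^ n := by
    rw [← sum_gaussCoeff_mul_binomCoeff a b hc n, Finset.sum_mul]
    refine Finset.sum_congr rfl fun k hk => ?_
    rw [← Nat.add_sub_cancel' (Nat.lt_succ_iff.1 (Finset.mem_range.1 hk)), pow_add]
    simp only [Nat.add_sub_cancel_left]
    ring
  simp only [hterm, hs.tsum_eq] at h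
  change ∑' n, gaussCoeff a b c n * x ^ n =
    (1 - x) ^ (c - a - b) * ∑' n, gaussCoeff (c - a) (c - b) c n * x ^ n
  rw [← h, mul_left_comm, ← cpow_add _ _ hx₁, add_neg_cancel, cpow_zero, mul_one]

theorem GaussF_comm (a b c x : ℂ) : GaussF a b c x = GaussF b a c x := by
  simp only [GaussF, mul_comm (poch a _)]

/-- Autotransformation formula (23): swapping `b` and `d` multiplies `Ψ_{pq}` by `(1−θ)^{d−b}`. -/
theorem Psi_autotransform (p q : ℕ) (hp : p ≤ 1) (hq : q ≤ 1)
    (a b c d a' b' e c' d' σ ρ : ℂ) (θ : ℝ)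
    (hσ : ‖σ‖ < 1) (hθ : |θ| < 1)
    (he : notNonposInt e) (hc' : notNonposInt c') (hd' : notNonposInt d') :
    PsiPQ p q a b c d a' b' e c' d' σ (θ : ℂ) ρ =
      ((1 : ℂ) - (θ : ℂ)) ^ (d - b) * PsiPQ p q a d c b a' b' e c' d' σ (θ : ℂ) ρ := by
  have hx : ‖(θ : ℂ)‖ < 1 := by simpa using hθ
  rw [PsiPQ, PsiPQ, ← tsum_mul_left]
  refine tsum_congr fun ⟨m, k⟩ => ?_
  have hc := (he.add_natCast m).add_natCast k
  rw [GaussF_euler _ _ hc hx, GaussF_comm]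
  ring_nf
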